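/- For 0 < α ≤ 2, the function φ(u) = exp(-|u|^α) is a characteristic function of a symmetric probability distribution on ℝ; equivalently, the function f(x) = (1/π) ∫_0^∞ exp(-t^α) cos(tx) dt defines a probability density: f ≥ 0 and ∫_ℝ f(x) dx = 1. -/

import Mathlib

open MeasureTheory Real
open Filter Topology Set

/-- The cosine transform of a Gaussian is a Gaussian. -/
lemma integral_exp_neg_mul_sq_mul_cos {b : ℝ} (hb : 0 < b) (x : ℝ) :
    ∫ t : ℝ, exp (-b * t ^ 2) * cos (t * x) = √(π / b) * exp (-x ^ 2 / (4 * b)) := by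
  have h := fourierIntegral_gaussian (b := (b : ℂ)) (by simpa using hb) (x : ℂ)
  have hint : Integrable fun t : ℝ ↦
      Complex.exp (Complex.I * x * t) * Complex.exp (-(b : ℂ) * t ^ 2) := by
    refine Integrable.bdd_mul (c := 1) ?_ (by fun_prop) (ae_of_all _ fun t ↦ ?_)
    · exact integrable_cexp_neg_mul_sq (by simpa using hb)
    · rw [Complex.norm_exp]; simp
  have hre := congrArg Complex.re h
  rw [← RCLike.re_eq_complex_re, ← integral_re hint] at hre
  have hR : ((π : ℂ) / b) ^ (1 / 2 : ℂ) * Complex.exp (-(x : ℂ) ^ 2 / (4 * b))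
      = ((√(π / b) * exp (-x ^ 2 / (4 * b)) : ℝ) : ℂ) := by
    rw [sqrt_eq_rpow, Complex.ofReal_mul, Complex.ofReal_cpow (by positivity)]
    push_cast
    rfl
  rw [hR, RCLike.re_eq_complex_re, Complex.ofReal_re] at hre
  rw [← hre]
  refine integral_congr_ae (ae_of_all _ fun t ↦ ?_)
  have h1 : Complex.exp (-(b : ℂ) * t ^ 2) = ((exp (-b * t ^ 2) : ℝ) : ℂ) := by push_cast; rfl
  have h2 : Complex.I * x * t = ((t * x : ℝ) : ℂ) * Complex.I := by push_cast; ring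
  simp only [h1, h2, Complex.re_mul_ofReal, Complex.exp_ofReal_mul_I_re]
  ring

/-- The half-line cosine transform of a Gaussian is nonnegative. -/
lemma integral_Ioi_exp_neg_mul_sq_mul_cos_nonneg {b : ℝ} (hb : 0 < b) (x : ℝ) :
    0 ≤ ∫ t in Ioi (0 : ℝ), exp (-b * t ^ 2) * cos (t * x) := by
  have h := integral_comp_abs (f := fun t ↦ exp (-b * t ^ 2) * cos (t * x))
  have h' : ∀ t : ℝ, cos (|t| * x) = cos (t * x) := fun t ↦ by
    rcases abs_choice t with h | h <;> simp [h]
  simp only [sq_abs, h', integral_exp_neg_mul_sq_mul_cos hb] at h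
  have : 0 ≤ √(π / b) * exp (-x ^ 2 / (4 * b)) := by positivity
  linarith

/-- Multiplying `g`, whose cosine transform is nonnegative, by the cosine transform of a
nonnegative weight preserves integrability and nonnegativity of the cosine transform. -/
lemma integral_mul_integral_mul_cos_nonneg {μ ν : Measure ℝ} [SFinite μ] [SFinite ν]
    {g w : ℝ → ℝ} (hg : Integrable g μ) (hw : Integrable w ν) (hw0 : ∀ᵐ y ∂ν, 0 ≤ w y)
    (hpos : ∀ x, 0 ≤ ∫ t, g t * cos (t * x) ∂μ) :
    Integrable (fun t ↦ g t * ∫ y, w y * cos (t * y) ∂ν) μ ∧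
      ∀ x, 0 ≤ ∫ t, (g t * ∫ y, w y * cos (t * y) ∂ν) * cos (t * x) ∂μ := by
  have hprod : Integrable (fun p : ℝ × ℝ ↦ (g p.1 * w p.2) * cos (p.1 * p.2)) (μ.prod ν) :=
    (hg.mul_prod hw).mul_bdd (c := 1) (by fun_prop) (ae_of_all _ fun p ↦ abs_cos_le_one _)
  refine ⟨?_, fun x ↦ ?_⟩
  · refine hprod.integral_prod_left.congr (ae_of_all _ fun t ↦ ?_)
    simp only [mul_assoc, integral_const_mul]
  · have hprodx : Integrable
        (Function.uncurry fun t y ↦ (g t * w y) * cos (t * y) * cos (t * x)) (μ.prod ν) :=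
      hprod.mul_bdd (c := 1) (by fun_prop) (ae_of_all _ fun p ↦ abs_cos_le_one _)
    have hcos : ∀ x, Integrable (fun t ↦ g t * cos (t * x)) μ := fun x ↦
      hg.mul_bdd (c := 1) (by fun_prop) (ae_of_all _ fun p ↦ abs_cos_le_one _)
    calc 0 ≤ ∫ y, w y / 2 * ((∫ t, g t * cos (t * (y - x)) ∂μ) +
            ∫ t, g t * cos (t * (y + x)) ∂μ) ∂ν := by
          refine integral_nonneg_of_ae ?_
          filter_upwards [hw0] with y hy
          exact mul_nonneg (by positivity) (add_nonneg (hpos _) (hpos _))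
      _ = ∫ y, ∫ t, (g t * w y) * cos (t * y) * cos (t * x) ∂μ ∂ν := by
          refine integral_congr_ae (ae_of_all _ fun y ↦ ?_)
          simp only
          rw [← integral_add (hcos _) (hcos _), ← integral_const_mul]
          refine integral_congr_ae (ae_of_all _ fun t ↦ ?_)
          simp only [mul_sub, mul_add, cos_sub, cos_add]
          ring
      _ = ∫ t, ∫ y, (g t * w y) * cos (t * y) * cos (t * x) ∂ν ∂μ :=
          (integral_integral_swap hprodx).symm
      _ = _ := by
          refine integral_congr_ae (ae_of_all _ fun t ↦ ?_)
          simp only [mul_assoc, integral_const_mul, ← integral_mul_const]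

/-- Iterated form of `integral_mul_integral_mul_cos_nonneg`. -/
lemma integral_mul_integral_mul_cos_pow_nonneg {μ ν : Measure ℝ} [SFinite μ] [SFinite ν]
    {g w : ℝ → ℝ} (hg : Integrable g μ) (hw : Integrable w ν) (hw0 : ∀ᵐ y ∂ν, 0 ≤ w y)
    (hpos : ∀ x, 0 ≤ ∫ t, g t * cos (t * x) ∂μ) (n : ℕ) :
    Integrable (fun t ↦ g t * (∫ y, w y * cos (t * y) ∂ν) ^ n) μ ∧
      ∀ x, 0 ≤ ∫ t, (g t * (∫ y, w y * cos (t * y) ∂ν) ^ n) * cos (t * x) ∂μ := by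
  induction n with
  | zero => simpa using ⟨hg, hpos⟩
  | succ n ih =>
    simpa only [pow_succ, mul_assoc] using
      integral_mul_integral_mul_cos_nonneg ih.1 hw hw0 ih.2

/-- The Lévy measure of a stable law of index `α < 2` integrates `1 - cos`. -/
lemma integrableOn_rpow_mul_one_sub_cos {α : ℝ} (h0 : 0 < α) (h2 : α < 2) :
    IntegrableOn (fun y : ℝ ↦ y ^ (-1 - α) * (1 - cos y)) (Ioi 0) := by
  have hm : ∀ s, AEStronglyMeasurable (fun y : ℝ ↦ y ^ (-1 - α) * (1 - cos y))
      (volume.restrict s) := fun s ↦ by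
    exact Measurable.aestronglyMeasurable (by fun_prop)
  rw [← Ioc_union_Ioi_eq_Ioi zero_le_one]
  refine IntegrableOn.union ?_ ?_
  · have h : IntegrableOn (fun y : ℝ ↦ y ^ (1 - α)) (Ioc 0 1) := by
      rw [← intervalIntegrable_iff_integrableOn_Ioc_of_le zero_le_one]
      exact intervalIntegral.intervalIntegrable_rpow' (by linarith)
    refine Integrable.mono' h (hm _) ?_
    filter_upwards [ae_restrict_mem measurableSet_Ioc] with y hy
    have hy0 : 0 < y := hy.1
    have hc : 0 ≤ 1 - cos y := by linarith [cos_le_one y]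
    rw [norm_of_nonneg (by positivity)]
    calc y ^ (-1 - α) * (1 - cos y) ≤ y ^ (-1 - α) * y ^ (2 : ℝ) := by
          gcongr
          rw [rpow_two]
          nlinarith [one_sub_sq_div_two_le_cos (x := y), sq_nonneg y]
      _ = y ^ (1 - α) := by rw [← rpow_add hy0]; ring_nf
  · have h : IntegrableOn (fun y : ℝ ↦ y ^ (-1 - α)) (Ioi 1) :=
      integrableOn_Ioi_rpow_of_lt (by linarith) one_pos
    refine Integrable.mono' (h.mul_const 2) (hm _) ?_
    filter_upwards [ae_restrict_mem measurableSet_Ioi] with y hy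
    have hy0 : 0 < y := one_pos.trans hy
    have hc : 0 ≤ 1 - cos y := by linarith [cos_le_one y]
    rw [norm_of_nonneg (by positivity)]
    gcongr
    linarith [neg_one_le_cos y]

lemma integral_rpow_mul_one_sub_cos_pos {α : ℝ} (h0 : 0 < α) (h2 : α < 2) :
    0 < ∫ y in Ioi (0 : ℝ), y ^ (-1 - α) * (1 - cos y) := by
  have hnn : ∀ y ∈ Ioi (0 : ℝ), 0 ≤ y ^ (-1 - α) * (1 - cos y) := fun y hy ↦
    mul_nonneg (rpow_nonneg (le_of_lt hy) _) (by linarith [cos_le_one y])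
  rw [setIntegral_pos_iff_support_of_nonneg_ae
    ((ae_restrict_mem measurableSet_Ioi).mono hnn) (integrableOn_rpow_mul_one_sub_cos h0 h2)]
  have hsub : Ioo (0 : ℝ) 1 ⊆
      (Function.support fun y : ℝ ↦ y ^ (-1 - α) * (1 - cos y)) ∩ Ioi 0 := by
    intro y hy
    refine ⟨mul_ne_zero (rpow_pos_of_pos hy.1 _).ne' ?_, hy.1⟩
    have := cos_lt_cos_of_nonneg_of_le_pi le_rfl (by linarith [pi_gt_three, hy.2] : y ≤ π) hy.1
    rw [cos_zero] at this
    linarith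
  exact (by simp : (0 : ENNReal) < volume (Ioo (0 : ℝ) 1)).trans_le (measure_mono hsub)

/-- Homogeneity in `t` of the Lévy exponent of the stable law. -/
lemma integral_rpow_mul_one_sub_cos_mul (α : ℝ) {t : ℝ} (ht : 0 < t) :
    ∫ y in Ioi (0 : ℝ), y ^ (-1 - α) * (1 - cos (t * y)) =
      t ^ α * ∫ y in Ioi (0 : ℝ), y ^ (-1 - α) * (1 - cos y) := by
  have h := integral_comp_mul_left_Ioi (fun y ↦ y ^ (-1 - α) * (1 - cos y)) 0 ht
  rw [mul_zero, smul_eq_mul] at h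
  have h' : ∫ y in Ioi (0 : ℝ), (t * y) ^ (-1 - α) * (1 - cos (t * y)) =
      t ^ (-1 - α) * ∫ y in Ioi (0 : ℝ), y ^ (-1 - α) * (1 - cos (t * y)) := by
    rw [← integral_const_mul]
    refine setIntegral_congr_fun measurableSet_Ioi fun y hy ↦ ?_
    rw [mul_rpow ht.le (le_of_lt hy), mul_assoc]
  rw [h'] at h
  have hp : t ^ (-1 - α) = t⁻¹ * (t ^ α)⁻¹ := by
    rw [← rpow_neg ht.le, ← rpow_neg_one, ← rpow_add ht]; ring_nf
  rw [hp] at h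
  have := rpow_pos_of_pos ht α
  field_simp at h
  linarith

/-- `exp (-t ^ α)` is a pointwise limit of powers of cosine transforms of probability densities
(rescaled Pareto densities). -/
lemma exists_tendsto_integral_mul_cos_pow {α : ℝ} (h0 : 0 < α) (h2 : α < 2) :
    ∃ (ε : ℕ → ℝ) (w : ℕ → ℝ → ℝ), (∀ n, IntegrableOn (w n) (Ioi (ε n))) ∧
      (∀ n, ∀ y ∈ Ioi (ε n), 0 ≤ w n y) ∧ (∀ n, ∫ y in Ioi (ε n), w n y = 1) ∧
      ∀ t > 0, Tendsto (fun n ↦ (∫ y in Ioi (ε n), w n y * cos (t * y)) ^ n) atTop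
        (𝓝 (exp (-t ^ α))) := by
  set C := ∫ y in Ioi (0 : ℝ), y ^ (-1 - α) * (1 - cos y) with hC
  have hCpos : 0 < C := integral_rpow_mul_one_sub_cos_pos h0 h2
  set c : ℕ → ℝ := fun n ↦ (C * (n + 1 : ℝ))⁻¹ with hc
  have hcpos : ∀ n, 0 < c n := fun n ↦ by positivity
  set ε : ℕ → ℝ := fun n ↦ (c n / α) ^ α⁻¹ with hε
  have hεpos : ∀ n, 0 < ε n := fun n ↦ rpow_pos_of_pos (div_pos (hcpos n) h0) _
  have hint : ∀ n, IntegrableOn (fun y : ℝ ↦ c n * y ^ (-1 - α)) (Ioi (ε n)) := fun n ↦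
    (integrableOn_Ioi_rpow_of_lt (by linarith) (hεpos n)).const_mul _
  have hone : ∀ n, ∫ y in Ioi (ε n), c n * y ^ (-1 - α) = 1 := fun n ↦ by
    have hcn := hcpos n
    rw [integral_const_mul, integral_Ioi_rpow_of_lt (by linarith) (hεpos n)]
    have : ε n ^ (-1 - α + 1) = (c n / α)⁻¹ := by
      rw [hε, ← rpow_mul (by positivity), ← rpow_neg_one (c n / α)]
      congr 1
      field_simp
      ring
    rw [this, show -1 - α + 1 = -α by ring]
    field_simp
  have hc0 : Tendsto c atTop (𝓝 0) := by
    refine Tendsto.inv_tendsto_atTop (Tendsto.const_mul_atTop hCpos ?_)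
    exact tendsto_atTop_add_const_right _ _ tendsto_natCast_atTop_atTop
  have hε0 : Tendsto ε atTop (𝓝 0) := by
    have := (hc0.div_const α).rpow_const (p := α⁻¹) (Or.inr (by positivity))
    rwa [zero_div, zero_rpow (by positivity)] at this
  refine ⟨ε, fun n y ↦ c n * y ^ (-1 - α), hint,
    fun n y hy ↦ mul_nonneg (hcpos n).le (rpow_nonneg ((hεpos n).trans hy).le _), hone,
    fun t ht ↦ ?_⟩
  have hK : IntegrableOn (fun y : ℝ ↦ y ^ (-1 - α) * (1 - cos (t * y))) (Ioi 0) := by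
    by_contra hcon
    have h := integral_rpow_mul_one_sub_cos_mul α ht
    rw [integral_undef hcon] at h
    exact (mul_pos (rpow_pos_of_pos ht α) hCpos).ne h
  have hlim : Tendsto (fun n ↦ ∫ y in Ioi (ε n), y ^ (-1 - α) * (1 - cos (t * y))) atTop
      (𝓝 (t ^ α * C)) := by
    rw [← integral_rpow_mul_one_sub_cos_mul α ht]
    refine ((aecover_Ioi_of_Ioi hε0).integral_tendsto_of_countably_generated hK).congr fun n ↦ ?_
    rw [Measure.restrict_restrict measurableSet_Ioi, inter_eq_left.mpr (Ioi_subset_Ioi (hεpos n).le)]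
  have hsub : ∀ n, ∫ y in Ioi (ε n), c n * y ^ (-1 - α) * cos (t * y) =
      1 + -(c n * ∫ y in Ioi (ε n), y ^ (-1 - α) * (1 - cos (t * y))) := fun n ↦ by
    have hcosint : IntegrableOn (fun y ↦ c n * y ^ (-1 - α) * cos (t * y)) (Ioi (ε n)) :=
      (hint n).mul_bdd (c := 1) (by fun_prop) (ae_of_all _ fun p ↦ abs_cos_le_one _)
    rw [← sub_eq_add_neg, eq_sub_iff_add_eq, ← integral_const_mul, ← integral_add hcosint]
    · refine Eq.trans (integral_congr_ae (ae_of_all _ fun y ↦ ?_)) (hone n)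
      simp only
      ring
    · exact (hK.mono_set (Ioi_subset_Ioi (hεpos n).le)).const_mul _
  simp_rw [hsub]
  refine tendsto_one_add_pow_exp_of_tendsto ?_
  have hnc : Tendsto (fun n : ℕ ↦ (n : ℝ) * c n) atTop (𝓝 C⁻¹) := by
    have := (tendsto_natCast_div_add_atTop (1 : ℝ)).mul_const C⁻¹
    rw [one_mul] at this
    refine this.congr fun n ↦ ?_
    rw [hc]
    field_simp
  have := (hnc.mul hlim).neg
  rw [show C⁻¹ * (t ^ α * C) = t ^ α by field_simp] at this
  refine this.congr fun n ↦ ?_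
  ring

lemma integrableOn_exp_neg_rpow {α : ℝ} (h0 : 0 < α) :
    IntegrableOn (fun t : ℝ ↦ exp (-t ^ α)) (Ioi 0) := by
  simpa using integrableOn_rpow_mul_exp_neg_rpow (s := 0) (by norm_num) h0

/-- The cosine transform of `exp (-t ^ α)` is nonnegative for `0 < α ≤ 2`. -/
lemma integral_exp_neg_rpow_mul_cos_nonneg {α : ℝ} (h0 : 0 < α) (h2 : α ≤ 2) (x : ℝ) :
    0 ≤ ∫ t in Ioi (0 : ℝ), exp (-t ^ α) * cos (t * x) := by
  rcases h2.eq_or_lt with rfl | h2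
  · simpa using integral_Ioi_exp_neg_mul_sq_mul_cos_nonneg one_pos x
  obtain ⟨ε, w, hint, hw0, hone, hlim⟩ := exists_tendsto_integral_mul_cos_pow h0 h2
  have hreg : ∀ b > 0, 0 ≤ ∫ t in Ioi (0 : ℝ), exp (-b * t ^ 2) * exp (-t ^ α) * cos (t * x) := by
    intro b hb
    have hg : IntegrableOn (fun t : ℝ ↦ exp (-b * t ^ 2)) (Ioi 0) :=
      (integrable_exp_neg_mul_sq hb).integrableOn
    have hpow n := integral_mul_integral_mul_cos_pow_nonneg hg (hint n)
      ((ae_restrict_mem measurableSet_Ioi).mono (hw0 n))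
      (integral_Ioi_exp_neg_mul_sq_mul_cos_nonneg hb) n
    refine ge_of_tendsto' (tendsto_integral_of_dominated_convergence _ (fun n ↦ ?_) hg
      (fun n ↦ ?_) ?_) fun n ↦ (hpow n).2 x
    · exact (hpow n).1.aestronglyMeasurable.mul (by fun_prop)
    · refine ae_of_all _ fun t ↦ ?_
      have hle : |∫ y in Ioi (ε n), w n y * cos (t * y)| ≤ 1 := by
        rw [← hone n, ← norm_eq_abs]
        refine norm_integral_le_of_norm_le (hint n) ?_
        filter_upwards [ae_restrict_mem measurableSet_Ioi] with y hy
        rw [norm_mul, norm_of_nonneg (hw0 n y hy)]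
        exact mul_le_of_le_one_right (hw0 n y hy) (abs_cos_le_one _)
      rw [norm_mul, norm_mul, norm_pow, norm_of_nonneg (exp_pos _).le, mul_assoc]
      exact mul_le_of_le_one_right (exp_pos _).le
        (mul_le_one₀ (pow_le_one₀ (abs_nonneg _) hle) (abs_nonneg _) (abs_cos_le_one _))
    · filter_upwards [ae_restrict_mem measurableSet_Ioi] with t ht
      exact ((hlim t ht).const_mul _).mul_const _
  refine ge_of_tendsto' (tendsto_integral_of_dominated_convergence
    (F := fun (n : ℕ) (t : ℝ) ↦ exp (-(1 / ((n : ℝ) + 1)) * t ^ 2) * exp (-t ^ α) * cos (t * x))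
    (fun t ↦ exp (-t ^ α)) (fun n ↦ ?_) (integrableOn_exp_neg_rpow h0) (fun n ↦ ?_) ?_)
    fun n ↦ hreg _ (by positivity)
  · exact Measurable.aestronglyMeasurable (by fun_prop)
  · refine ae_of_all _ fun t ↦ ?_
    rw [norm_mul, norm_mul, norm_of_nonneg (exp_pos _).le, norm_of_nonneg (exp_pos _).le]
    have h1 : exp (-(1 / ((n : ℝ) + 1)) * t ^ 2) ≤ 1 := by
      rw [exp_le_one_iff, neg_mul, neg_nonpos]
      positivity
    calc _ ≤ 1 * exp (-t ^ α) * 1 := by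
          gcongr
          exact abs_cos_le_one _
      _ = _ := by ring
  · refine ae_of_all _ fun t ↦ ?_
    have h := ((tendsto_one_div_add_atTop_nhds_zero_nat (𝕜 := ℝ)).neg.mul_const (t ^ 2)).rexp
    simpa using (h.mul_const (exp (-t ^ α))).mul_const (cos (t * x))

/-- Gaussian-regularized total mass of the cosine transform of `exp (-t ^ α)`. -/
lemma integral_exp_mul_integral_exp_neg_rpow_mul_cos {α η : ℝ} (h0 : 0 < α) (hη : 0 < η) :
    ∫ x : ℝ, exp (-(η / 2) ^ 2 * x ^ 2) * ∫ t in Ioi (0 : ℝ), exp (-t ^ α) * cos (t * x) =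
      2 * √π * ∫ s in Ioi (0 : ℝ), exp (-(η * s) ^ α) * exp (-s ^ 2) := by
  have hb : 0 < (η / 2) ^ 2 := by positivity
  have hprod : Integrable (Function.uncurry fun x t : ℝ ↦
      exp (-(η / 2) ^ 2 * x ^ 2) * exp (-t ^ α) * cos (x * t))
      (volume.prod (volume.restrict (Ioi 0))) :=
    ((integrable_exp_neg_mul_sq hb).mul_prod (integrableOn_exp_neg_rpow h0)).mul_bdd (c := 1)
      (by fun_prop) (ae_of_all _ fun p ↦ abs_cos_le_one _)
  have hs : √(π / (η / 2) ^ 2) = 2 * √π / η := by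
    rw [sqrt_div' _ hb.le, sqrt_sq (by positivity)]
    field_simp
  calc _ = ∫ x : ℝ, ∫ t in Ioi (0 : ℝ), exp (-(η / 2) ^ 2 * x ^ 2) * exp (-t ^ α) * cos (x * t) := by
        refine integral_congr_ae (ae_of_all _ fun x ↦ ?_)
        simp only [← integral_const_mul, mul_assoc, mul_comm x]
    _ = ∫ t in Ioi (0 : ℝ), ∫ x : ℝ, exp (-(η / 2) ^ 2 * x ^ 2) * exp (-t ^ α) * cos (x * t) :=
        integral_integral_swap hprod
    _ = ∫ t in Ioi (0 : ℝ), 2 * √π / η * (exp (-t ^ α) * exp (-(η⁻¹ * t) ^ 2)) := by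
        refine integral_congr_ae (ae_of_all _ fun t ↦ ?_)
        have := integral_exp_neg_mul_sq_mul_cos hb t
        simp only [mul_right_comm _ (exp (-t ^ α)), integral_mul_const, this, hs]
        rw [show -t ^ 2 / (4 * (η / 2) ^ 2) = -(η⁻¹ * t) ^ 2 by field_simp; ring]
        ring
    _ = _ := by
        have h := integral_comp_mul_left_Ioi
          (fun t ↦ exp (-t ^ α) * exp (-(η⁻¹ * t) ^ 2)) 0 hη
        simp only [inv_mul_cancel_left₀ hη.ne', mul_zero, smul_eq_mul] at h
        rw [integral_const_mul, h]
        ring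

/-- Total mass of the cosine transform of `exp (-t ^ α)`. -/
lemma integral_integral_exp_neg_rpow_mul_cos {α : ℝ} (h0 : 0 < α) (h2 : α ≤ 2) :
    ∫ x : ℝ, ∫ t in Ioi (0 : ℝ), exp (-t ^ α) * cos (t * x) = π := by
  set F : ℝ → ℝ := fun x ↦ ∫ t in Ioi (0 : ℝ), exp (-t ^ α) * cos (t * x) with hF
  have hF0 : ∀ x, 0 ≤ F x := integral_exp_neg_rpow_mul_cos_nonneg h0 h2
  have hFle : ∀ x, ‖F x‖ ≤ ∫ t in Ioi (0 : ℝ), exp (-t ^ α) := fun x ↦ by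
    refine norm_integral_le_of_norm_le (integrableOn_exp_neg_rpow h0) (ae_of_all _ fun t ↦ ?_)
    rw [norm_mul, norm_of_nonneg (exp_pos _).le]
    exact mul_le_of_le_one_right (exp_pos _).le (abs_cos_le_one _)
  have hFm : AEStronglyMeasurable F volume := by
    refine Continuous.aestronglyMeasurable (continuous_of_dominated
      (bound := fun t ↦ exp (-t ^ α)) (fun x ↦ Measurable.aestronglyMeasurable (by fun_prop))
      (fun x ↦ ae_of_all _ fun t ↦ ?_) (integrableOn_exp_neg_rpow h0)
      (ae_of_all _ fun t ↦ by fun_prop))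
    rw [norm_mul, norm_of_nonneg (exp_pos _).le]
    exact mul_le_of_le_one_right (exp_pos _).le (abs_cos_le_one _)
  set η : ℕ → ℝ := fun n ↦ 1 / ((n : ℝ) + 1) with hη
  have hηpos : ∀ n, 0 < η n := fun n ↦ by positivity
  have hη0 : Tendsto η atTop (𝓝 0) := tendsto_one_div_add_atTop_nhds_zero_nat
  set G : ℕ → ℝ → ℝ := fun n x ↦ exp (-(η n / 2) ^ 2 * x ^ 2) * F x with hG
  have hGint : ∀ n, Integrable (G n) := fun n ↦
    (integrable_exp_neg_mul_sq (pow_pos (half_pos (hηpos n)) 2)).mul_bdd hFm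
      (ae_of_all _ hFle)
  have hGF : ∀ x, Tendsto (fun n ↦ G n x) atTop (𝓝 (F x)) := fun x ↦ by
    have h := ((((hη0.div_const 2).pow 2).neg.mul_const (x ^ 2)).rexp).mul_const (F x)
    simpa [hG] using h
  have hgauss : ∫ s in Ioi (0 : ℝ), exp (-s ^ 2) = √π / 2 := by
    simpa using integral_gaussian_Ioi 1
  have hgint : IntegrableOn (fun s : ℝ ↦ exp (-s ^ 2)) (Ioi 0) := by
    simpa using (integrable_exp_neg_mul_sq one_pos).integrableOn
  have hmass : Tendsto (fun n ↦ ∫ x, G n x) atTop (𝓝 π) := by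
    have hlim : Tendsto (fun n ↦ ∫ s in Ioi (0 : ℝ), exp (-(η n * s) ^ α) * exp (-s ^ 2)) atTop
        (𝓝 (∫ s in Ioi (0 : ℝ), exp (-s ^ 2))) := by
      refine tendsto_integral_of_dominated_convergence (fun s ↦ exp (-s ^ 2))
        (fun n ↦ Measurable.aestronglyMeasurable (by fun_prop)) hgint (fun n ↦ ?_) ?_
      · filter_upwards [ae_restrict_mem measurableSet_Ioi] with s hs
        rw [norm_mul, norm_of_nonneg (exp_pos _).le, norm_of_nonneg (exp_pos _).le]
        refine mul_le_of_le_one_left (exp_pos _).le ?_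
        rw [exp_le_one_iff, neg_nonpos]
        exact rpow_nonneg (mul_nonneg (hηpos n).le (le_of_lt hs)) _
      · refine ae_of_all _ fun s ↦ ?_
        have h := (((hη0.mul_const s).rpow_const (p := α)
          (Or.inr h0.le)).neg.rexp).mul_const (exp (-s ^ 2))
        simpa [zero_rpow h0.ne'] using h
    have h := hlim.const_mul (2 * √π)
    rw [hgauss, show 2 * √π * (√π / 2) = √π * √π by ring, mul_self_sqrt pi_pos.le] at h
    exact h.congr fun n ↦
      (integral_exp_mul_integral_exp_neg_rpow_mul_cos h0 (hηpos n)).symm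
  have hFint : Integrable F := by
    refine integrable_of_tendsto (ae_of_all _ hGF) (fun n ↦ (hGint n).aestronglyMeasurable) ?_
    have hnorm : ∀ n, ∫⁻ x, ‖G n x‖ₑ = ENNReal.ofReal (∫ x, G n x) := fun n ↦ by
      rw [← ofReal_integral_norm_eq_lintegral_enorm (hGint n)]
      congr 1
      refine integral_congr_ae (ae_of_all _ fun x ↦ ?_)
      exact norm_of_nonneg (mul_nonneg (exp_pos _).le (hF0 x))
    simp_rw [hnorm]
    rw [(ENNReal.tendsto_ofReal hmass).liminf_eq]
    exact ENNReal.ofReal_ne_top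
  refine tendsto_nhds_unique (tendsto_integral_of_dominated_convergence F
    (fun n ↦ (hGint n).aestronglyMeasurable) hFint (fun n ↦ ae_of_all _ fun x ↦ ?_)
    (ae_of_all _ hGF)) hmass
  rw [norm_of_nonneg (mul_nonneg (exp_pos _).le (hF0 x))]
  refine mul_le_of_le_one_left (hF0 x) ?_
  rw [exp_le_one_iff, neg_mul, neg_nonpos]
  positivity

/-- For `0 < α ≤ 2`, the function `f(x) = (1/π) ∫_0^∞ exp(-t^α) cos(tx) dt` is a probability
density on `ℝ`: it is nonnegative and integrates to `1`. Equivalently, `exp(-|u|^α)` is the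
characteristic function of a symmetric probability distribution (the symmetric α-stable law). -/
theorem stable_density (α : ℝ) (hα1 : 0 < α) (hα2 : α ≤ 2) :
    (∀ x : ℝ,
        0 ≤ (1 / Real.pi) * ∫ t in Set.Ioi (0 : ℝ), Real.exp (-t ^ α) * Real.cos (t * x)) ∧
      (∫ x : ℝ,
          (1 / Real.pi) * ∫ t in Set.Ioi (0 : ℝ), Real.exp (-t ^ α) * Real.cos (t * x)) = 1 := by
  refine ⟨fun x ↦ mul_nonneg (by positivity)
    (integral_exp_neg_rpow_mul_cos_nonneg hα1 hα2 x), ?_⟩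
  rw [integral_const_mul, integral_integral_exp_neg_rpow_mul_cos hα1 hα2]
  field_simp
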